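/- arXiv:2406.12859 — 11 statements merged into one kernel-verified Lean document; each statement's English description precedes it below -/
import Mathlib

section
/- Let (L,T) be a Reynolds Lie–Yamaguti algebra of weight λ and let (V;ρ,θ,T_V) be a representation of it. Define operations on the direct sum L ⊕ V by [x+u, y+v] := [x,y] + ρ(x)v - ρ(y)u, {x+u, y+v, z+w} := {x,y,z} + D(x,y)w - θ(x,z)v + θ(y,z)u, and (T ⊕ T_V)(x+u) := T(x) + T_V(u), for all x,y,z in L and u,v,w in V, where D(x,y) := θ(y,x) - θ(x,y) - ρ([x,y]) + ρ(x)ρ(y) - ρ(y)ρ(x). Then (L ⊕ V, [-,-], {-,-,-}, T ⊕ T_V) is a Reynolds Lie–Yamaguti algebra of weight λ. -/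
open Finset

variable (K : Type*) [Field K] [CharZero K]
variable {L : Type*} [AddCommGroup L] [Module K L]
variable {V : Type*} [AddCommGroup V] [Module K V]

/-- A Lie–Yamaguti algebra structure given by a bilinear bracket `br` and a
trilinear bracket `tr`, satisfying (LY1)–(LY6). -/
def IsLYAlgebra (br : L → L → L) (tr : L → L → L → L) : Prop :=
  (∀ y, IsLinearMap K fun x => br x y) ∧ (∀ x, IsLinearMap K (br x)) ∧
  (∀ y z, IsLinearMap K fun x => tr x y z) ∧ (∀ x z, IsLinearMap K fun y => tr x y z) ∧
  (∀ x y, IsLinearMap K (tr x y)) ∧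
  (∀ x y, br x y = - br y x) ∧
  (∀ x y z, tr x y z = - tr y x z) ∧
  (∀ x y z, br (br x y) z + br (br z x) y + br (br y z) x
      + tr x y z + tr z x y + tr y z x = 0) ∧
  (∀ x y z a, tr (br x y) z a + tr (br z x) y a + tr (br y z) x a = 0) ∧
  (∀ a b x y, tr a b (br x y) = br (tr a b x) y + br x (tr a b y)) ∧
  (∀ a b x y z, tr a b (tr x y z)
      = tr (tr a b x) y z + tr x (tr a b y) z + tr x y (tr a b z))

/-- `T` is a Reynolds operator of weight `lam` on the Lie–Yamaguti algebra `(L, br, tr)`. -/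
def IsReynoldsOp (lam : K) (br : L → L → L) (tr : L → L → L → L) (T : L → L) : Prop :=
  IsLinearMap K T ∧
  (∀ x y, br (T x) (T y) = T (br (T x) y + br x (T y) + lam • br (T x) (T y))) ∧
  (∀ x y z, tr (T x) (T y) (T z)
    = T (tr x (T y) (T z) + tr (T x) y (T z) + tr (T x) (T y) z
        + (2 * lam) • tr (T x) (T y) (T z)))

/-- The map `D(x,y) = θ(y,x) - θ(x,y) - ρ([x,y]) + ρ(x)ρ(y) - ρ(y)ρ(x)`. -/
def DMap (br : L → L → L) (rho : L → V → V) (theta : L → L → V → V)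
    (x y : L) (u : V) : V :=
  theta y x u - theta x y u - rho (br x y) u + rho x (rho y u) - rho y (rho x u)

/-- `(V; ρ, θ)` is a representation of the Lie–Yamaguti algebra `(L, br, tr)`. -/
def IsLYRep (br : L → L → L) (tr : L → L → L → L)
    (rho : L → V → V) (theta : L → L → V → V) : Prop :=
  (∀ u, IsLinearMap K fun x => rho x u) ∧ (∀ x, IsLinearMap K (rho x)) ∧
  (∀ y u, IsLinearMap K fun x => theta x y u) ∧
  (∀ x u, IsLinearMap K fun y => theta x y u) ∧
  (∀ x y, IsLinearMap K (theta x y)) ∧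
  (∀ x y a u, theta (br x y) a u = theta x a (rho y u) - theta y a (rho x u)) ∧
  (∀ a b x u, DMap br rho theta a b (rho x u)
      = rho x (DMap br rho theta a b u) + rho (tr a b x) u) ∧
  (∀ x a b u, theta x (br a b) u = rho a (theta x b u) - rho b (theta x a u)) ∧
  (∀ a b x y u, DMap br rho theta a b (theta x y u)
      = theta x y (DMap br rho theta a b u) + theta (tr a b x) y u + theta x (tr a b y) u) ∧
  (∀ a x y z u, theta a (tr x y z) u
      = theta y z (theta a x u) - theta x z (theta a y u)
        + DMap br rho theta x y (theta a z u))

/-- `(V; ρ, θ, T_V)` is a representation of the Reynolds Lie–Yamaguti algebra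
`(L, br, tr, T)` of weight `lam`. -/
def IsReynoldsRep (lam : K) (br : L → L → L) (tr : L → L → L → L) (T : L → L)
    (rho : L → V → V) (theta : L → L → V → V) (TV : V → V) : Prop :=
  IsLYRep K br tr rho theta ∧ IsLinearMap K TV ∧
  (∀ x u, rho (T x) (TV u)
      = TV (rho (T x) u + rho x (TV u) + lam • rho (T x) (TV u))) ∧
  (∀ x y u, theta (T x) (T y) (TV u)
      = TV (theta (T x) (T y) u + theta (T x) y (TV u) + theta x (T y) (TV u)
          + (2 * lam) • theta (T x) (T y) (TV u)))

/-- The deformed binary bracket `[x,y]_T`. -/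
def brT (lam : K) (br : L → L → L) (T : L → L) (x y : L) : L :=
  br (T x) y + br x (T y) + lam • br (T x) (T y)

/-- The deformed ternary bracket `{x,y,z}_T`. -/
def trT (lam : K) (tr : L → L → L → L) (T : L → L) (x y z : L) : L :=
  tr x (T y) (T z) + tr (T x) y (T z) + tr (T x) (T y) z
    + (2 * lam) • tr (T x) (T y) (T z)

/-- The deformed representation map `ρ_T`. -/
def rhoT (lam : K) (rho : L → V → V) (T : L → L) (TV : V → V) (x : L) (u : V) : V :=
  rho (T x) u - TV (lam • rho (T x) u + rho x u)

/-- The deformed representation map `θ_T`. -/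
def thetaT (lam : K) (theta : L → L → V → V) (T : L → L) (TV : V → V)
    (x y : L) (u : V) : V :=
  theta (T x) (T y) u
    - TV ((2 * lam) • theta (T x) (T y) u + theta (T x) y u + theta x (T y) u)

/-- The deformed map `D_T`. -/
def DT (lam : K) (br : L → L → L) (rho : L → V → V) (theta : L → L → V → V)
    (T : L → L) (TV : V → V) (x y : L) (u : V) : V :=
  DMap br rho theta (T x) (T y) u
    - TV ((2 * lam) • DMap br rho theta (T x) (T y) u
        + DMap br rho theta x (T y) u + DMap br rho theta (T x) y u)

section Representation

set_option linter.unusedSectionVars false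

variable {K} {br : L → L → L} {tr : L → L → L → L} {rho : L → V → V} {theta : L → L → V → V}

theorem IsLYRep.isLinearMap_DMap (h : IsLYRep K br tr rho theta) (x y : L) :
    IsLinearMap K (DMap br rho theta x y) := by
  obtain ⟨-, hr, -, -, ht, -⟩ := h
  constructor
  · intro u v
    simp only [DMap, (hr _).map_add, (ht _ _).map_add]
    abel
  · intro c u
    simp only [DMap, (hr _).map_smul, (ht _ _).map_smul]
    module

theorem IsLYRep.DMap_swap (hLY : IsLYAlgebra K br tr) (h : IsLYRep K br tr rho theta)
    (x y : L) (u : V) : DMap br rho theta x y u = -DMap br rho theta y x u := by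
  obtain ⟨-, -, -, -, -, hskew, -⟩ := hLY
  simp only [DMap, hskew x y, (h.1 u).map_neg]
  abel

theorem IsLYRep.isLinearMap_DMap_left (hLY : IsLYAlgebra K br tr)
    (h : IsLYRep K br tr rho theta) (y : L) (u : V) :
    IsLinearMap K fun x => DMap br rho theta x y u := by
  obtain ⟨hb, -⟩ := hLY
  obtain ⟨hl, hr, ht₁, ht₂, -⟩ := h
  constructor
  · intro x z
    simp only [DMap, (hl _).map_add, (hr _).map_add, (hb _).map_add, (ht₁ _ _).map_add,
      (ht₂ _ _).map_add]
    abel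
  · intro c x
    simp only [DMap, (hl _).map_smul, (hr _).map_smul, (hb _).map_smul, (ht₁ _ _).map_smul,
      (ht₂ _ _).map_smul]
    module

theorem IsLYRep.isLinearMap_DMap_right (hLY : IsLYAlgebra K br tr)
    (h : IsLYRep K br tr rho theta) (x : L) (u : V) :
    IsLinearMap K fun y => DMap br rho theta x y u := by
  obtain ⟨-, hb, -⟩ := hLY
  obtain ⟨hl, hr, ht₁, ht₂, -⟩ := h
  constructor
  · intro y z
    simp only [DMap, (hl _).map_add, (hr _).map_add, (hb _).map_add, (ht₁ _ _).map_add,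
      (ht₂ _ _).map_add]
    abel
  · intro c y
    simp only [DMap, (hl _).map_smul, (hr _).map_smul, (hb _).map_smul, (ht₁ _ _).map_smul,
      (ht₂ _ _).map_smul]
    module

/-- The cyclic identity satisfied by `D`, corresponding to (LY4). -/
theorem IsLYRep.DMap_cyclic (hLY : IsLYAlgebra K br tr) (h : IsLYRep K br tr rho theta)
    (x y z : L) (u : V) :
    DMap br rho theta (br x y) z u + DMap br rho theta (br z x) y u
      + DMap br rho theta (br y z) x u = 0 := by
  obtain ⟨-, -, -, -, -, -, -, hcyc, -⟩ := hLY
  obtain ⟨hl, hr, -, -, -, hbr, hD, hbr', -⟩ := h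
  have key := congrArg (fun w => rho w u) (hcyc x y z)
  have h₁ := hD x y z u
  have h₂ := hD z x y u
  have h₃ := hD y z x u
  simp only [(hl _).map_add, (hl _).map_zero] at key
  simp only [DMap, (hr _).map_add, (hr _).map_sub] at h₁ h₂ h₃
  simp only [DMap, hbr, hbr']
  linear_combination (norm := module) -(h₁ + h₂ + h₃) - key

/-- `D(a,b)` acts as a derivation on `D`, corresponding to (LY6). -/
theorem IsLYRep.DMap_DMap (hLY : IsLYAlgebra K br tr) (h : IsLYRep K br tr rho theta)
    (a b x y : L) (u : V) :
    DMap br rho theta a b (DMap br rho theta x y u)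
      = DMap br rho theta (tr a b x) y u + DMap br rho theta x (tr a b y) u
        + DMap br rho theta x y (DMap br rho theta a b u) := by
  obtain ⟨-, -, -, -, -, -, -, -, -, hder, -⟩ := hLY
  have hlin := h.isLinearMap_DMap a b
  obtain ⟨hl, hr, -, -, -, -, hD, -, hD', -⟩ := h
  have e : ∀ (c d : L) (v : V), DMap br rho theta c d v = theta d c v - theta c d v
      - rho (br c d) v + rho c (rho d v) - rho d (rho c v) := fun _ _ _ => rfl
  rw [e x y u, e (tr a b x), e x (tr a b y), e x y]
  simp only [hlin.map_sub, hlin.map_add, hD, hD', hder, (hl _).map_add, (hr _).map_add]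
  abel

/-- The compatibility of `D` with a pair of Reynolds operators. -/
theorem IsReynoldsRep.DMap_reynolds {lam : K} {T : L → L} {TV : V → V}
    (hT : IsReynoldsOp K lam br tr T) (h : IsReynoldsRep K lam br tr T rho theta TV)
    (x y : L) (u : V) :
    DMap br rho theta (T x) (T y) (TV u)
      = TV (DMap br rho theta (T x) (T y) u + DMap br rho theta (T x) y (TV u)
          + DMap br rho theta x (T y) (TV u)
          + (2 * lam) • DMap br rho theta (T x) (T y) (TV u)) := by
  obtain ⟨-, hTbr, -⟩ := hT
  obtain ⟨⟨hl, hr, -⟩, hTV, hρ, hθ⟩ := h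
  have comp : ∀ x y, rho (T x) (rho (T y) (TV u)) = TV (rho (T x) (rho (T y) u)
      + rho (T x) (rho y (TV u)) + rho x (rho (T y) (TV u))
      + (2 * lam) • rho (T x) (rho (T y) (TV u))) := by
    intro x y
    conv_lhs => rw [hρ y u, hρ x, ← hρ y u]
    congr 1
    simp only [(hr _).map_add, (hr _).map_smul]
    module
  have bracket : rho (br (T x) (T y)) (TV u) = TV (rho (br (T x) (T y)) u
      + rho (br (T x) y) (TV u) + rho (br x (T y)) (TV u)
      + (2 * lam) • rho (br (T x) (T y)) (TV u)) := by
    conv_lhs => rw [hTbr x y, hρ, ← hTbr x y]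
    congr 1
    simp only [(hl _).map_add, (hl _).map_smul]
    module
  have expand : DMap br rho theta (T x) (T y) (TV u) = theta (T y) (T x) (TV u)
      - theta (T x) (T y) (TV u) - rho (br (T x) (T y)) (TV u)
      + rho (T x) (rho (T y) (TV u)) - rho (T y) (rho (T x) (TV u)) := rfl
  conv_lhs =>
    rw [expand, hθ y x, hθ x y, comp x y, comp y x, bracket, ← hTV.map_sub, ← hTV.map_sub,
      ← hTV.map_add, ← hTV.map_sub]
  congr 1
  simp only [DMap]
  module

/-- The semidirect product of a Lie–Yamaguti algebra with a representation. -/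
theorem IsLYAlgebra.semidirectProduct (hLY : IsLYAlgebra K br tr)
    (h : IsLYRep K br tr rho theta) :
    IsLYAlgebra (L := L × V) K
      (fun a b => (br a.1 b.1, rho a.1 b.2 - rho b.1 a.2))
      (fun a b c => (tr a.1 b.1 c.1,
        DMap br rho theta a.1 b.1 c.2 - theta a.1 c.1 b.2 + theta b.1 c.1 a.2)) := by
  have hD := h.isLinearMap_DMap
  have hD₁ := h.isLinearMap_DMap_left hLY
  have hD₂ := h.isLinearMap_DMap_right hLY
  have hswap := h.DMap_swap hLY
  have hcyc := h.DMap_cyclic hLY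
  have hDD := h.DMap_DMap hLY
  obtain ⟨hb₁, hb₂, ht₁, ht₂, ht₃, ly1, ly2, ly3, ly4, ly5, ly6⟩ := hLY
  obtain ⟨hρ₁, hρ₂, hθ₁, hθ₂, hθ₃, r1, r2, r3, r4, r5⟩ := h
  refine ⟨fun y => ⟨fun x z => ?_, fun c x => ?_⟩, fun y => ⟨fun x z => ?_, fun c x => ?_⟩,
    fun y z => ⟨fun x w => ?_, fun c x => ?_⟩, fun y z => ⟨fun x w => ?_, fun c x => ?_⟩,
    fun y z => ⟨fun x w => ?_, fun c x => ?_⟩, fun x y => ?_, fun x y z => ?_,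
    fun x y z => ?_, fun x y z a => ?_, fun a b x y => ?_, fun a b x y z => ?_⟩
  rotate_left 10
  · exact Prod.ext (ly1 _ _) (by simp)
  · refine Prod.ext (ly2 _ _ _) ?_
    simp only [Prod.snd_neg, hswap x.1 y.1]
    abel
  · refine Prod.ext (ly3 _ _ _) ?_
    simp only [Prod.snd_add, Prod.snd_zero, (hρ₂ _).map_sub, DMap, ly1 z.1 x.1,
      (hρ₁ _).map_neg]
    abel
  · refine Prod.ext (ly4 _ _ _ _) ?_
    simp only [Prod.snd_add, Prod.snd_zero, (hθ₃ _ _).map_sub, r1]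
    have := hcyc x.1 y.1 z.1 a.2
    linear_combination (norm := module) this
  · refine Prod.ext (ly5 _ _ _ _) ?_
    simp only [Prod.snd_add, (hD _ _).map_sub, (hρ₂ _).map_sub, (hρ₂ _).map_add, r2, r3]
    abel
  · refine Prod.ext (ly6 _ _ _ _ _) ?_
    simp only [Prod.snd_add, (hD _ _).map_sub, (hD _ _).map_add, (hθ₃ _ _).map_sub,
      (hθ₃ _ _).map_add, hDD a.1 b.1, r4 a.1 b.1, r5 _ x.1 y.1 z.1]
    abel
  all_goals
    ext
    · simp only [Prod.fst_add, Prod.smul_fst, (hb₁ _).map_add, (hb₁ _).map_smul,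
        (hb₂ _).map_add, (hb₂ _).map_smul, (ht₁ _ _).map_add, (ht₁ _ _).map_smul,
        (ht₂ _ _).map_add, (ht₂ _ _).map_smul, (ht₃ _ _).map_add, (ht₃ _ _).map_smul]
    · simp only [Prod.fst_add, Prod.smul_fst, Prod.snd_add, Prod.smul_snd, (hρ₁ _).map_add,
        (hρ₁ _).map_smul, (hρ₂ _).map_add, (hρ₂ _).map_smul, (hθ₁ _ _).map_add,
        (hθ₁ _ _).map_smul, (hθ₂ _ _).map_add, (hθ₂ _ _).map_smul, (hθ₃ _ _).map_add,
        (hθ₃ _ _).map_smul, (hD _ _).map_add, (hD _ _).map_smul, (hD₁ _ _).map_add,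
        (hD₁ _ _).map_smul, (hD₂ _ _).map_add, (hD₂ _ _).map_smul]
      module

/-- The direct sum of the Reynolds operators on the semidirect product. -/
theorem IsReynoldsOp.semidirectProduct {lam : K} {T : L → L} {TV : V → V}
    (hT : IsReynoldsOp K lam br tr T) (h : IsReynoldsRep K lam br tr T rho theta TV) :
    IsReynoldsOp (L := L × V) K lam
      (fun a b => (br a.1 b.1, rho a.1 b.2 - rho b.1 a.2))
      (fun a b c => (tr a.1 b.1 c.1,
        DMap br rho theta a.1 b.1 c.2 - theta a.1 c.1 b.2 + theta b.1 c.1 a.2))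
      (fun a => (T a.1, TV a.2)) := by
  have hD := h.DMap_reynolds hT
  obtain ⟨hTl, hTbr, hTtr⟩ := hT
  obtain ⟨-, hTV, hρ, hθ⟩ := h
  refine ⟨⟨fun x y => Prod.ext (hTl.map_add _ _) (hTV.map_add _ _),
    fun c x => Prod.ext (hTl.map_smul _ _) (hTV.map_smul _ _)⟩,
    fun x y => Prod.ext (hTbr _ _) ?_, fun x y z => Prod.ext (hTtr _ _ _) ?_⟩
  · simp only [Prod.snd_add, Prod.smul_snd]
    conv_lhs => rw [hρ x.1, hρ y.1, ← hTV.map_sub]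
    congr 1
    module
  · simp only [Prod.snd_add, Prod.smul_snd]
    conv_lhs => rw [hD, hθ x.1, hθ y.1, ← hTV.map_sub, ← hTV.map_add]
    congr 1
    module

end Representation

/-- the semidirect product `L ⊕ V` is a Reynolds Lie–Yamaguti algebra
of weight `lam`. -/
theorem stmt0 (lam : K) (br : L → L → L) (tr : L → L → L → L) (T : L → L)
    (rho : L → V → V) (theta : L → L → V → V) (TV : V → V)
    (hLY : IsLYAlgebra K br tr) (hT : IsReynoldsOp K lam br tr T)
    (hrep : IsReynoldsRep K lam br tr T rho theta TV) :
    IsLYAlgebra (L := L × V) K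
      (fun a b => (br a.1 b.1, rho a.1 b.2 - rho b.1 a.2))
      (fun a b c => (tr a.1 b.1 c.1,
        DMap br rho theta a.1 b.1 c.2 - theta a.1 c.1 b.2 + theta b.1 c.1 a.2)) ∧
    IsReynoldsOp (L := L × V) K lam
      (fun a b => (br a.1 b.1, rho a.1 b.2 - rho b.1 a.2))
      (fun a b c => (tr a.1 b.1 c.1,
        DMap br rho theta a.1 b.1 c.2 - theta a.1 c.1 b.2 + theta b.1 c.1 a.2))
      (fun a => (T a.1, TV a.2)) := by
  exact ⟨hLY.semidirectProduct hrep.1, hT.semidirectProduct hrep⟩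
end

section
/- Let (L,T) be a Reynolds Lie–Yamaguti algebra of weight λ. Then L equipped with the operations [x,y]_T := [Tx,y] + [x,Ty] + λ[Tx,Ty] and {x,y,z}_T := {x,Ty,Tz} + {Tx,y,Tz} + {Tx,Ty,z} + 2λ{Tx,Ty,Tz} is a Lie–Yamaguti algebra (denoted L_T). -/
open Finset

variable (K : Type*) [Field K] [CharZero K]
variable {L : Type*} [AddCommGroup L] [Module K L]
variable {V : Type*} [AddCommGroup V] [Module K V]

/-- If `(L,T)` is a Reynolds Lie–Yamaguti algebra of weight `lam`, then
`(L, [-,-]_T, {-,-,-}_T)` is a Lie–Yamaguti algebra. -/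
theorem stmt1 (lam : K) (br : L → L → L) (tr : L → L → L → L) (T : L → L)
    (hLY : IsLYAlgebra K br tr) (hT : IsReynoldsOp K lam br tr T) :
    IsLYAlgebra K (brT K lam br T) (trT K lam tr T) := by
  obtain ⟨hb1, hb2, ht1, ht2, ht3, hb, ht, h3, h4, h5, h6⟩ := hLY
  obtain ⟨hTl, hTb, hTt⟩ := hT
  have ba1 (x x' y) : br (x + x') y = br x y + br x' y := (hb1 y).map_add x x'
  have bs1 (c : K) (x y) : br (c • x) y = c • br x y := (hb1 y).map_smul c x
  have ba2 (x y y') : br x (y + y') = br x y + br x y' := (hb2 x).map_add y y'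
  have bs2 (c : K) (x y) : br x (c • y) = c • br x y := (hb2 x).map_smul c y
  have ta1 (x x' y z) : tr (x + x') y z = tr x y z + tr x' y z := (ht1 y z).map_add x x'
  have ts1 (c : K) (x y z) : tr (c • x) y z = c • tr x y z := (ht1 y z).map_smul c x
  have ta2 (x y y' z) : tr x (y + y') z = tr x y z + tr x y' z := (ht2 x z).map_add y y'
  have ts2 (c : K) (x y z) : tr x (c • y) z = c • tr x y z := (ht2 x z).map_smul c y
  have ta3 (x y z z') : tr x y (z + z') = tr x y z + tr x y z' := (ht3 x y).map_add z z'
  have ts3 (c : K) (x y z) : tr x y (c • z) = c • tr x y z := (ht3 x y).map_smul c z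
  have Ta (x y) : T (x + y) = T x + T y := hTl.map_add x y
  have Ts (c : K) (x) : T (c • x) = c • T x := hTl.map_smul c x
  have Tb (x y) : T (brT K lam br T x y) = br (T x) (T y) := (hTb x y).symm
  have Tt (x y z) : T (trT K lam tr T x y z) = tr (T x) (T y) (T z) := (hTt x y z).symm
  have brT_eq (x y) : brT K lam br T x y
      = br (T x) y + br x (T y) + lam • br (T x) (T y) := rfl
  have trT_eq (x y z) : trT K lam tr T x y z
      = tr x (T y) (T z) + tr (T x) y (T z) + tr (T x) (T y) z
        + (2 * lam) • tr (T x) (T y) (T z) := rfl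
  refine ⟨fun y => ⟨fun x x' => ?_, fun c x => ?_⟩, fun x => ⟨fun y y' => ?_, fun c y => ?_⟩,
    fun y z => ⟨fun x x' => ?_, fun c x => ?_⟩, fun x z => ⟨fun y y' => ?_, fun c y => ?_⟩,
    fun x y => ⟨fun z z' => ?_, fun c z => ?_⟩, fun x y => ?_, fun x y z => ?_,
    fun x y z => ?_, fun x y z a => ?_, fun a b x y => ?_, fun a b x y z => ?_⟩
  iterate 4
    · simp only [brT_eq, Ta, Ts, ba1, bs1, ba2, bs2]
      module
  iterate 6
    · simp only [trT_eq, Ta, Ts, ta1, ts1, ta2, ts2, ta3, ts3]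
      module
  · rw [brT_eq, brT_eq, hb (T x) y, hb x (T y), hb (T x) (T y)]
    module
  · rw [trT_eq, trT_eq, ht x (T y), ht (T x) y, ht (T x) (T y), ht (T x) (T y)]
    module
  · rw [brT_eq (brT K lam br T x y), brT_eq (brT K lam br T z x), brT_eq (brT K lam br T y z)]
    simp only [Tb]
    simp only [brT_eq, trT_eq, ba1, bs1]
    linear_combination (norm := module) h3 (T x) (T y) z + h3 (T x) y (T z) + h3 x (T y) (T z)
      + (2 * lam) • h3 (T x) (T y) (T z)
  · rw [trT_eq (brT K lam br T x y), trT_eq (brT K lam br T z x), trT_eq (brT K lam br T y z)]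
    simp only [Tb]
    simp only [brT_eq, ta1, ts1]
    linear_combination (norm := module) h4 (T x) (T y) z (T a) + h4 (T x) y (T z) (T a)
      + h4 x (T y) (T z) (T a) + h4 (T x) (T y) (T z) a
      + (3 * lam) • h4 (T x) (T y) (T z) (T a)
  · rw [trT_eq a b (brT K lam br T x y), brT_eq (trT K lam tr T a b x),
      brT_eq x (trT K lam tr T a b y)]
    simp only [Tb, Tt]
    simp only [brT_eq, trT_eq, ba1, bs1, ba2, bs2, ta3, ts3]
    linear_combination (norm := module) h5 a (T b) (T x) (T y) + h5 (T a) b (T x) (T y)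
      + h5 (T a) (T b) x (T y) + h5 (T a) (T b) (T x) y
      + (3 * lam) • h5 (T a) (T b) (T x) (T y)
  · rw [trT_eq a b (trT K lam tr T x y z), trT_eq (trT K lam tr T a b x),
      trT_eq x (trT K lam tr T a b y), trT_eq x y (trT K lam tr T a b z)]
    simp only [Tt]
    simp only [trT_eq, ta1, ts1, ta2, ts2, ta3, ts3]
    linear_combination (norm := module) h6 a (T b) (T x) (T y) (T z) + h6 (T a) b (T x) (T y) (T z)
      + h6 (T a) (T b) x (T y) (T z) + h6 (T a) (T b) (T x) y (T z)
      + h6 (T a) (T b) (T x) (T y) z + (4 * lam) • h6 (T a) (T b) (T x) (T y) (T z)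
end

section
/- Let (L,T) be a Reynolds Lie–Yamaguti algebra of weight λ and let L_T denote L equipped with the operations [x,y]_T := [Tx,y] + [x,Ty] + λ[Tx,Ty] and {x,y,z}_T := {x,Ty,Tz} + {Tx,y,Tz} + {Tx,Ty,z} + 2λ{Tx,Ty,Tz}. Then T is also a Reynolds operator of weight λ on L_T; that is, for all x,y,z in L: [Tx,Ty]_T = T([Tx,y]_T + [x,Ty]_T + λ[Tx,Ty]_T) and {Tx,Ty,Tz}_T = T({x,Ty,Tz}_T + {Tx,y,Tz}_T + {Tx,Ty,z}_T + 2λ{Tx,Ty,Tz}_T). -/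
open Finset

variable (K : Type*) [Field K] [CharZero K]
variable {L : Type*} [AddCommGroup L] [Module K L]
variable {V : Type*} [AddCommGroup V] [Module K V]

/-- `T` is also a Reynolds operator of weight `lam` on the descendent
Lie–Yamaguti algebra `L_T`. -/
theorem stmt2 (lam : K) (br : L → L → L) (tr : L → L → L → L) (T : L → L)
    (hLY : IsLYAlgebra K br tr) (hT : IsReynoldsOp K lam br tr T) :
    IsReynoldsOp K lam (brT K lam br T) (trT K lam tr T) T := by
  obtain ⟨hlin, hbr, htr⟩ := hT
  have hbrT : ∀ x y, T (brT K lam br T x y) = br (T x) (T y) := fun x y => (hbr x y).symm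
  have htrT : ∀ x y z, T (trT K lam tr T x y z) = tr (T x) (T y) (T z) :=
    fun x y z => (htr x y z).symm
  refine ⟨hlin, fun x y => ?_, fun x y z => ?_⟩
  · simp only [hlin.map_add, hlin.map_smul, hbrT]
    rfl
  · simp only [hlin.map_add, hlin.map_smul, htrT]
    rfl
end

section
/- Let (L,T) be a Reynolds Lie–Yamaguti algebra of weight λ and (V;ρ,θ,T_V) a representation of it. Define ρ_T(x)u := ρ(Tx)u - T_V(λρ(Tx)u + ρ(x)u) and θ_T(x,y)u := θ(Tx,Ty)u - T_V(2λθ(Tx,Ty)u + θ(Tx,y)u + θ(x,Ty)u). Then the Reynolds compatibility conditions hold for (ρ_T,θ_T,T_V): for all x,y in L and u in V, ρ_T(Tx)T_V u = T_V(ρ_T(Tx)u + ρ_T(x)T_V u + λρ_T(Tx)T_V u) and θ_T(Tx,Ty)T_V u = T_V(θ_T(Tx,Ty)u + θ_T(Tx,y)T_V u + θ_T(x,Ty)T_V u + 2λθ_T(Tx,Ty)T_V u). -/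
open Finset

variable (K : Type*) [Field K] [CharZero K]
variable {L : Type*} [AddCommGroup L] [Module K L]
variable {V : Type*} [AddCommGroup V] [Module K V]

theorem rhoT_apply_TV (lam : K) (rho : L → V → V) (T : L → L) (TV : V → V)
    (hTV : IsLinearMap K TV)
    (hrho : ∀ x u, rho (T x) (TV u)
      = TV (rho (T x) u + rho x (TV u) + lam • rho (T x) (TV u))) (x : L) (u : V) :
    rhoT K lam rho T TV x (TV u) = TV (rho (T x) u) := by
  rw [rhoT, sub_eq_iff_eq_add, ← hTV.map_add, hrho x u]
  congr 1
  rw [← hrho x u]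
  abel

theorem thetaT_apply_TV (lam : K) (theta : L → L → V → V) (T : L → L) (TV : V → V)
    (hTV : IsLinearMap K TV)
    (htheta : ∀ x y u, theta (T x) (T y) (TV u)
      = TV (theta (T x) (T y) u + theta (T x) y (TV u) + theta x (T y) (TV u)
          + (2 * lam) • theta (T x) (T y) (TV u))) (x y : L) (u : V) :
    thetaT K lam theta T TV x y (TV u) = TV (theta (T x) (T y) u) := by
  rw [thetaT, sub_eq_iff_eq_add, ← hTV.map_add, htheta x y u]
  congr 1
  rw [← htheta x y u]
  abel

/-- the Reynolds compatibility conditions hold for `(ρ_T, θ_T, T_V)`. -/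
theorem stmt4 (lam : K) (br : L → L → L) (tr : L → L → L → L) (T : L → L)
    (rho : L → V → V) (theta : L → L → V → V) (TV : V → V)
    (hLY : IsLYAlgebra K br tr) (hT : IsReynoldsOp K lam br tr T)
    (hrep : IsReynoldsRep K lam br tr T rho theta TV) :
    (∀ x u, rhoT K lam rho T TV (T x) (TV u)
        = TV (rhoT K lam rho T TV (T x) u + rhoT K lam rho T TV x (TV u)
            + lam • rhoT K lam rho T TV (T x) (TV u))) ∧
    (∀ x y u, thetaT K lam theta T TV (T x) (T y) (TV u)
        = TV (thetaT K lam theta T TV (T x) (T y) u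
            + thetaT K lam theta T TV (T x) y (TV u)
            + thetaT K lam theta T TV x (T y) (TV u)
            + (2 * lam) • thetaT K lam theta T TV (T x) (T y) (TV u))) := by
  obtain ⟨-, hTV, hrho, htheta⟩ := hrep
  refine ⟨fun x u => ?_, fun x y u => ?_⟩
  · simp only [rhoT_apply_TV K lam rho T TV hTV hrho]
    congr 1
    rw [rhoT, hTV.map_add, hTV.map_smul]
    abel
  · simp only [thetaT_apply_TV K lam theta T TV hTV htheta]
    congr 1
    rw [thetaT, hTV.map_add, hTV.map_add, hTV.map_smul]
    abel
end

section
/- Let (L̂, î, p̂ data) be an abelian extension of a Reynolds Lie–Yamaguti algebra (L,T) of weight λ by (V,T_V), and let s : L → L̂ be a section of p. Define ρ : L → gl(V) and θ : L × L → gl(V) by i(ρ(x)u) = [s(x),i(u)]̂ and i(θ(x,y)u) = {i(u),s(x),s(y)}̂. Then (V;ρ,θ) is a representation of the Lie–Yamaguti algebra L, and (V;ρ,θ,T_V) is a representation of the Reynolds Lie–Yamaguti algebra (L,T) of weight λ. -/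
open Finset

variable (K : Type*) [Field K] [CharZero K]
variable {L : Type*} [AddCommGroup L] [Module K L]
variable {V : Type*} [AddCommGroup V] [Module K V]

/-- the representation of `(L,T)` on `(V,T_V)` induced by a section of an
abelian extension. -/
theorem stmt7 {LH : Type*} [AddCommGroup LH] [Module K LH]
    (lam : K) (br : L → L → L) (tr : L → L → L → L) (T : L → L)
    (brH : LH → LH → LH) (trH : LH → LH → LH → LH) (TH : LH → LH)
    (TV : V → V)
    (hLY : IsLYAlgebra K br tr) (hT : IsReynoldsOp K lam br tr T)
    (hLYH : IsLYAlgebra K brH trH) (hTH : IsReynoldsOp K lam brH trH TH)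
    (hTV : IsLinearMap K TV)
    (i : V →ₗ[K] LH) (p : LH →ₗ[K] L)
    (hi : Function.Injective i) (hp : Function.Surjective p)
    (hpbr : ∀ a b, p (brH a b) = br (p a) (p b))
    (hptr : ∀ a b c, p (trH a b c) = tr (p a) (p b) (p c))
    (hpT : ∀ a, p (TH a) = T (p a))
    (hker : ∀ a, p a = 0 ↔ ∃ u, i u = a)
    (hTi : ∀ u, TH (i u) = i (TV u))
    (hab₁ : ∀ u v, brH (i u) (i v) = 0)
    (hab₂ : ∀ (a : LH) (u v : V), trH a (i u) (i v) = 0)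
    (hab₃ : ∀ (a : LH) (u v : V), trH (i u) (i v) a = 0)
    (s : L → LH) (hs : IsLinearMap K s) (hsec : ∀ x, p (s x) = x)
    (rho : L → V → V) (theta : L → L → V → V)
    (hrho : ∀ x u, i (rho x u) = brH (s x) (i u))
    (htheta : ∀ x y u, i (theta x y u) = trH (i u) (s x) (s y)) :
    IsLYRep K br tr rho theta ∧
    IsReynoldsRep K lam br tr T rho theta TV := by
  obtain ⟨brL, brR, tr1, tr2, tr3, brA, trA, ly3, ly4, ly5, ly6⟩ := hLYH
  obtain ⟨-, hTH₂, hTH₃⟩ := hTH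
  have split : ∀ a : LH, ∃ v, a = s (p a) + i v := by
    intro a
    obtain ⟨v, hv⟩ := (hker (a - s (p a))).1 (by rw [map_sub, hsec, sub_self])
    exact ⟨v, by rw [hv]; abel⟩
  -- The brackets with an element of `V` depend only on classes modulo `V`.
  have br_i : ∀ a u, brH a (i u) = i (rho (p a) u) := by
    intro a u
    obtain ⟨v, hv⟩ := split a
    calc brH a (i u) = brH (s (p a) + i v) (i u) := by rw [← hv]
      _ = i (rho (p a) u) := by rw [(brL (i u)).map_add, hab₁, add_zero, hrho]
  have i_br : ∀ a u, brH (i u) a = i (-rho (p a) u) := by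
    intro a u
    rw [brA, br_i, map_neg]
  have hab₄ : ∀ (a : LH) (u v : V), trH (i u) a (i v) = 0 := by
    intro a u v
    rw [trA, hab₂, neg_zero]
  have tr_i₁ : ∀ a b u, trH (i u) a b = i (theta (p a) (p b) u) := by
    intro a b u
    obtain ⟨v, hv⟩ := split a
    obtain ⟨w, hw⟩ := split b
    calc trH (i u) a b = trH (i u) (s (p a) + i v) (s (p b) + i w) := by rw [← hv, ← hw]
      _ = i (theta (p a) (p b) u) := by
        rw [(tr2 (i u) _).map_add, hab₃, add_zero, (tr3 (i u) _).map_add, hab₄, add_zero,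
          htheta]
  have tr_i₂ : ∀ a b u, trH a (i u) b = i (-theta (p a) (p b) u) := by
    intro a b u
    rw [trA, tr_i₁, map_neg]
  have tr_i₃ : ∀ a b u, trH a b (i u) = i (DMap br rho theta (p a) (p b) u) := by
    intro a b u
    have h := ly3 a b (i u)
    rw [brA (i u), (brL _).map_neg] at h
    simp only [br_i, i_br, tr_i₁, tr_i₂, hpbr, map_neg] at h
    simp only [DMap, map_sub, map_add]
    rw [← sub_eq_zero, ← h]
    abel
  have hrep : IsLYRep K br tr rho theta := by
    refine ⟨fun u => ⟨fun x y => hi ?_, fun c x => hi ?_⟩,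
      fun x => ⟨fun u v => hi ?_, fun c u => hi ?_⟩,
      fun y u => ⟨fun x x' => hi ?_, fun c x => hi ?_⟩,
      fun x u => ⟨fun y y' => hi ?_, fun c y => hi ?_⟩,
      fun x y => ⟨fun u v => hi ?_, fun c u => hi ?_⟩,
      fun x y a u => hi ?_, fun a b x u => hi ?_, fun x a b u => hi ?_,
      fun a b x y u => hi ?_, fun a x y z u => hi ?_⟩
    · simp only [map_add, hrho, hs.map_add, (brL _).map_add]
    · simp only [map_smul, hrho, hs.map_smul, (brL _).map_smul]
    · simp only [map_add, hrho, (brR _).map_add]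
    · simp only [map_smul, hrho, (brR _).map_smul]
    · simp only [map_add, htheta, hs.map_add, (tr2 _ _).map_add]
    · simp only [map_smul, htheta, hs.map_smul, (tr2 _ _).map_smul]
    · simp only [map_add, htheta, hs.map_add, (tr3 _ _).map_add]
    · simp only [map_smul, htheta, hs.map_smul, (tr3 _ _).map_smul]
    · simp only [map_add, htheta, (tr1 _ _).map_add]
    · simp only [map_smul, htheta, (tr1 _ _).map_smul]
    · have h := ly4 (s x) (s y) (i u) (s a)
      rw [brA (i u), (tr1 _ _).map_neg] at h
      simp only [br_i, tr_i₁, tr_i₂, hpbr, hsec, map_neg] at h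
      rw [map_sub, ← sub_eq_zero, ← neg_eq_zero, ← h]
      abel
    · simpa only [br_i, i_br, tr_i₃, hptr, hsec, map_add, add_comm] using
        ly5 (s a) (s b) (s x) (i u)
    · have h := ly5 (i u) (s x) (s a) (s b)
      simp only [br_i, i_br, tr_i₁, hpbr, hsec, map_neg] at h
      rw [h, map_sub]
      abel
    · have h := ly6 (s a) (s b) (i u) (s x) (s y)
      simpa only [tr_i₁, tr_i₃, hptr, hsec, map_add] using h
    · have h := ly6 (i u) (s a) (s x) (s y) (s z)
      simp only [tr_i₁, tr_i₂, tr_i₃, hptr, hsec, map_neg] at h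
      rw [h, map_add, map_sub]
      abel
  refine ⟨hrep, hrep, hTV, fun x u => hi ?_, fun x y u => hi ?_⟩
  · have h := hTH₂ (s x) (i u)
    simpa only [hTi, br_i, hpT, hsec, ← map_add, ← map_smul] using h
  · have h := hTH₃ (i u) (s x) (s y)
    simp only [hTi, tr_i₁, hpT, hsec, ← map_add, ← map_smul] at h
    rw [h, add_right_comm (theta (T x) (T y) u)]
end

section
/- Let an abelian extension of a Reynolds Lie–Yamaguti algebra (L,T) of weight λ by (V,T_V) be given, with maps i : V → L̂ and p : L̂ → L, and let s₁, s₂ : L → L̂ be two sections of p. For k = 1,2 define ρ_k : L → gl(V) and θ_k : L × L → gl(V) by i(ρ_k(x)u) = [s_k(x),i(u)]̂ and i(θ_k(x,y)u) = {i(u),s_k(x),s_k(y)}̂. Then ρ₁ = ρ₂ and θ₁ = θ₂; i.e. different sections induce the same representation of (L,T) on (V,T_V). -/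
open Finset

variable (K : Type*) [Field K] [CharZero K]
variable {L : Type*} [AddCommGroup L] [Module K L]
variable {V : Type*} [AddCommGroup V] [Module K V]

/-- two sections of an abelian extension induce the same representation. -/
theorem stmt9 {LH : Type*} [AddCommGroup LH] [Module K LH]
    (lam : K) (br : L → L → L) (tr : L → L → L → L) (T : L → L)
    (brH : LH → LH → LH) (trH : LH → LH → LH → LH) (TH : LH → LH)
    (TV : V → V)
    (hLY : IsLYAlgebra K br tr) (hT : IsReynoldsOp K lam br tr T)
    (hLYH : IsLYAlgebra K brH trH) (hTH : IsReynoldsOp K lam brH trH TH)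
    (hTV : IsLinearMap K TV)
    (i : V →ₗ[K] LH) (p : LH →ₗ[K] L)
    (hi : Function.Injective i) (hp : Function.Surjective p)
    (hpbr : ∀ a b, p (brH a b) = br (p a) (p b))
    (hptr : ∀ a b c, p (trH a b c) = tr (p a) (p b) (p c))
    (hpT : ∀ a, p (TH a) = T (p a))
    (hker : ∀ a, p a = 0 ↔ ∃ u, i u = a)
    (hTi : ∀ u, TH (i u) = i (TV u))
    (hab₁ : ∀ u v, brH (i u) (i v) = 0)
    (hab₂ : ∀ (a : LH) (u v : V), trH a (i u) (i v) = 0)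
    (hab₃ : ∀ (a : LH) (u v : V), trH (i u) (i v) a = 0)
    (s₁ s₂ : L → LH) (hs₁ : IsLinearMap K s₁) (hs₂ : IsLinearMap K s₂)
    (hsec₁ : ∀ x, p (s₁ x) = x) (hsec₂ : ∀ x, p (s₂ x) = x)
    (rho₁ rho₂ : L → V → V) (theta₁ theta₂ : L → L → V → V)
    (hrho₁ : ∀ x u, i (rho₁ x u) = brH (s₁ x) (i u))
    (htheta₁ : ∀ x y u, i (theta₁ x y u) = trH (i u) (s₁ x) (s₁ y))
    (hrho₂ : ∀ x u, i (rho₂ x u) = brH (s₂ x) (i u))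
    (htheta₂ : ∀ x y u, i (theta₂ x y u) = trH (i u) (s₂ x) (s₂ y)) :
    rho₁ = rho₂ ∧ theta₁ = theta₂ := by
  obtain ⟨hadd₁, -, -, htadd₂, htadd₃, -, hskew, -⟩ := hLYH
  have hdiff : ∀ x, ∃ w, s₁ x = s₂ x + i w := fun x => by
    obtain ⟨w, hw⟩ := (hker (s₁ x - s₂ x)).1 (by rw [map_sub, hsec₁, hsec₂, sub_self])
    exact ⟨w, by rw [hw, add_sub_cancel]⟩
  have hab₄ : ∀ u a v, trH (i u) a (i v) = 0 := fun u a v => by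
    rw [hskew, hab₂, neg_zero]
  refine ⟨funext₂ fun x u => hi ?_, funext₃ fun x y u => hi ?_⟩
  · obtain ⟨w, hw⟩ := hdiff x
    rw [hrho₁, hrho₂, hw, (hadd₁ (i u)).map_add, hab₁, add_zero]
  · obtain ⟨w, hw⟩ := hdiff x
    obtain ⟨v, hv⟩ := hdiff y
    rw [htheta₁, htheta₂, hw, hv, (htadd₃ _ _).map_add, hab₄, add_zero,
      (htadd₂ _ _).map_add, hab₃, add_zero]
end

section
/- Let an abelian extension of a Reynolds Lie–Yamaguti algebra (L,T) of weight λ by (V,T_V) be given, with maps i : V → L̂ and p : L̂ → L, and let s₁, s₂ : L → L̂ be two sections of p. Let ρ, θ, D denote the induced (section-independent) representation maps, defined by i(ρ(x)u) = [s₁(x),i(u)]̂, i(θ(x,y)u) = {i(u),s₁(x),s₁(y)}̂ and D(x,y) := θ(y,x) - θ(x,y) - ρ([x,y]) + ρ(x)ρ(y) - ρ(y)ρ(x). For k = 1,2 define ν_k, ψ_k, χ_k by i(ν_k(x,y)) = [s_k(x),s_k(y)]̂ - s_k([x,y]), i(ψ_k(x,y,z)) = {s_k(x),s_k(y),s_k(z)}̂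 - s_k({x,y,z}), i(χ_k(x)) = T̂(s_k(x)) - s_k(T(x)), and let ι : L → V be the unique linear map with i(ι(x)) = s₁(x) - s₂(x). Then for all x,y,z in L: ν₁(x,y) = ν₂(x,y) + ρ(x)ι(y) - ρ(y)ι(x) - ι([x,y]); ψ₁(x,y,z) = ψ₂(x,y,z) + D(x,y)ι(z) + θ(y,z)ι(x) - θ(x,z)ι(y) - ι({x,y,z}); and χ₁(x) = χ₂(x) + T_V(ι(x)) - ι(T(x)). In particular the 2-cocycles induced by the two sections differ by a coboundary. -/
open Finset

variable (K : Type*) [Field K] [CharZero K]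
variable {L : Type*} [AddCommGroup L] [Module K L]
variable {V : Type*} [AddCommGroup V] [Module K V]

/-- the 2-cocycles induced by two sections of an abelian extension
differ by the coboundary of `ι`. -/
theorem stmt10 {LH : Type*} [AddCommGroup LH] [Module K LH]
    (lam : K) (br : L → L → L) (tr : L → L → L → L) (T : L → L)
    (brH : LH → LH → LH) (trH : LH → LH → LH → LH) (TH : LH → LH)
    (TV : V → V)
    (hLY : IsLYAlgebra K br tr) (hT : IsReynoldsOp K lam br tr T)
    (hLYH : IsLYAlgebra K brH trH) (hTH : IsReynoldsOp K lam brH trH TH)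
    (hTV : IsLinearMap K TV)
    (i : V →ₗ[K] LH) (p : LH →ₗ[K] L)
    (hi : Function.Injective i) (hp : Function.Surjective p)
    (hpbr : ∀ a b, p (brH a b) = br (p a) (p b))
    (hptr : ∀ a b c, p (trH a b c) = tr (p a) (p b) (p c))
    (hpT : ∀ a, p (TH a) = T (p a))
    (hker : ∀ a, p a = 0 ↔ ∃ u, i u = a)
    (hTi : ∀ u, TH (i u) = i (TV u))
    (hab₁ : ∀ u v, brH (i u) (i v) = 0)
    (hab₂ : ∀ (a : LH) (u v : V), trH a (i u) (i v) = 0)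
    (hab₃ : ∀ (a : LH) (u v : V), trH (i u) (i v) a = 0)
    (s₁ s₂ : L → LH) (hs₁ : IsLinearMap K s₁) (hs₂ : IsLinearMap K s₂)
    (hsec₁ : ∀ x, p (s₁ x) = x) (hsec₂ : ∀ x, p (s₂ x) = x)
    (rho : L → V → V) (theta : L → L → V → V)
    (hrho : ∀ x u, i (rho x u) = brH (s₁ x) (i u))
    (htheta : ∀ x y u, i (theta x y u) = trH (i u) (s₁ x) (s₁ y))
    (nu₁ nu₂ : L → L → V) (psi₁ psi₂ : L → L → L → V) (chi₁ chi₂ : L → V)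
    (hnu₁ : ∀ x y, i (nu₁ x y) = brH (s₁ x) (s₁ y) - s₁ (br x y))
    (hpsi₁ : ∀ x y z, i (psi₁ x y z) = trH (s₁ x) (s₁ y) (s₁ z) - s₁ (tr x y z))
    (hchi₁ : ∀ x, i (chi₁ x) = TH (s₁ x) - s₁ (T x))
    (hnu₂ : ∀ x y, i (nu₂ x y) = brH (s₂ x) (s₂ y) - s₂ (br x y))
    (hpsi₂ : ∀ x y z, i (psi₂ x y z) = trH (s₂ x) (s₂ y) (s₂ z) - s₂ (tr x y z))
    (hchi₂ : ∀ x, i (chi₂ x) = TH (s₂ x) - s₂ (T x))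
    (iota : L → V) (hiota : ∀ x, i (iota x) = s₁ x - s₂ x) :
    (∀ x y, nu₁ x y = nu₂ x y + rho x (iota y) - rho y (iota x) - iota (br x y)) ∧
    (∀ x y z, psi₁ x y z
      = psi₂ x y z + DMap br rho theta x y (iota z) + theta y z (iota x)
        - theta x z (iota y) - iota (tr x y z)) ∧
    (∀ x, chi₁ x = chi₂ x + TV (iota x) - iota (T x)) := by
  obtain ⟨hb1, hb2, ht1, ht2, ht3, hskew, htskew, hjac, -⟩ := hLYH
  have hs₂_eq : ∀ x, s₂ x = s₁ x - i (iota x) := fun x => by rw [hiota]; abel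
  have br_sub_left : ∀ a b c, brH (a - b) c = brH a c - brH b c := fun a b c => (hb1 c).map_sub a b
  have br_sub_right : ∀ a b c, brH a (b - c) = brH a b - brH a c := fun a b c => (hb2 a).map_sub b c
  have br_add_left : ∀ a b c, brH (a + b) c = brH a c + brH b c := fun a b c => (hb1 c).map_add a b
  have br_neg_left : ∀ a b, brH (-a) b = -brH a b := fun a b => (hb1 b).map_neg a
  have tr_sub_left : ∀ a b c d, trH (a - b) c d = trH a c d - trH b c d :=
    fun a b c d => (ht1 c d).map_sub a b
  have tr_sub_mid : ∀ a b c d, trH a (b - c) d = trH a b d - trH a c d :=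
    fun a b c d => (ht2 a d).map_sub b c
  have tr_sub_right : ∀ a b c d, trH a b (c - d) = trH a b c - trH a b d :=
    fun a b c d => (ht3 a b).map_sub c d
  have hab_outer : ∀ a u v, trH (i u) a (i v) = 0 := fun a u v => by
    rw [htskew, hab₂, neg_zero]
  have hD : ∀ x y u, i (DMap br rho theta x y u) = trH (s₁ x) (s₁ y) (i u) := by
    intro x y u
    have hbr : brH (s₁ x) (s₁ y) = i (nu₁ x y) + s₁ (br x y) := by rw [hnu₁]; abel
    have h := hjac (s₁ x) (s₁ y) (i u)
    rw [hbr, br_add_left, hab₁, zero_add, hskew (i u) (s₁ x), br_neg_left,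
      hskew (brH (s₁ x) (i u)) (s₁ y), hskew (brH (s₁ y) (i u)) (s₁ x),
      htskew (s₁ y) (i u) (s₁ x)] at h
    simp only [DMap, map_add, map_sub, hrho, htheta]
    rw [← sub_eq_zero, ← neg_eq_zero, ← h]
    abel
  refine ⟨fun x y => hi ?_, fun x y z => hi ?_, fun x => hi ?_⟩
  · simp only [map_add, map_sub, hnu₁, hnu₂, hrho, hs₂_eq, br_sub_left, br_sub_right, hab₁]
    rw [hskew (i (iota x)) (s₁ y)]
    abel
  · simp only [map_add, map_sub, hpsi₁, hpsi₂, hD, htheta, hs₂_eq, tr_sub_left, tr_sub_mid,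
      tr_sub_right, hab₂, hab₃, hab_outer]
    rw [htskew (s₁ x) (i (iota y)) (s₁ z)]
    abel
  · simp only [map_add, map_sub, hchi₁, hchi₂, hs₂_eq, hTH.1.map_sub, hTi]
    abel
end

section
/- Let (L,T) be a Reynolds Lie–Yamaguti algebra of weight λ and (V;ρ,θ,T_V) a representation of it, with D(x,y) := θ(y,x) - θ(x,y) - ρ([x,y]) + ρ(x)ρ(y) - ρ(y)ρ(x). For k = 1,2 let ν_k : L × L → V be bilinear, ψ_k : L × L × L → V trilinear and χ_k : L → V linear, and suppose both triples make L ⊕ V into a Reynolds Lie–Yamaguti algebra of weight λ under the operations [x+u, y+v]_{ν_k} := [x,y] + ρ(x)v - ρ(y)u + ν_k(x,y), {x+u, y+v, z+w}_{ψ_k} := {x,y,z} + θ(y,z)u - θ(x,z)v + D(x,y)w + ψ_k(x,y,z), T_{χ_k}(x+u) := T(x) + χ_k(x) + T_V(u). Suppose there is a linear map ι : L → V such that for all x,y,z in L: ν₁(x,y) = ν₂(x,y) + ρ(x)ι(y) - ρ(y)ι(x) - ι([x,y]); ψ₁(x,y,z) = ψ₂(x,y,z) + D(x,y)ι(z) +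 θ(y,z)ι(x) - θ(x,z)ι(y) - ι({x,y,z}); χ₁(x) = χ₂(x) + T_V(ι(x)) - ι(T(x)). Then the map φ_ι : L ⊕ V → L ⊕ V, φ_ι(x+u) := x + ι(x) + u, is a bijective linear map satisfying φ_ι([A,B]_{ν₁}) = [φ_ι(A),φ_ι(B)]_{ν₂}, φ_ι({A,B,C}_{ψ₁}) = {φ_ι(A),φ_ι(B),φ_ι(C)}_{ψ₂} and φ_ι∘T_{χ₁} = T_{χ₂}∘φ_ι for all A,B,C in L ⊕ V, and it restricts to the identity on V and induces the identity on L; i.e. the two abelian extensions are equivalent. -/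
open Finset

variable (K : Type*) [Field K] [CharZero K]
variable {L : Type*} [AddCommGroup L] [Module K L]
variable {V : Type*} [AddCommGroup V] [Module K V]

/-- if the two 2-cocycles `((ν₁,ψ₁),χ₁)` and `((ν₂,ψ₂),χ₂)` differ by the
coboundary of `ι`, then `φ_ι(x+u) = x + ι(x) + u` is an equivalence between the two
associated abelian extensions `L ⊕ V`. -/
theorem stmt12 (lam : K) (br : L → L → L) (tr : L → L → L → L) (T : L → L)
    (rho : L → V → V) (theta : L → L → V → V) (TV : V → V)
    (hLY : IsLYAlgebra K br tr) (hT : IsReynoldsOp K lam br tr T)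
    (hrep : IsReynoldsRep K lam br tr T rho theta TV)
    (nu₁ nu₂ : L → L → V) (psi₁ psi₂ : L → L → L → V) (chi₁ chi₂ : L → V)
    (hext₁ : IsLYAlgebra (L := L × V) K
        (fun a b => (br a.1 b.1, rho a.1 b.2 - rho b.1 a.2 + nu₁ a.1 b.1))
        (fun a b c => (tr a.1 b.1 c.1,
          theta b.1 c.1 a.2 - theta a.1 c.1 b.2 + DMap br rho theta a.1 b.1 c.2
            + psi₁ a.1 b.1 c.1)) ∧
      IsReynoldsOp (L := L × V) K lam
        (fun a b => (br a.1 b.1, rho a.1 b.2 - rho b.1 a.2 + nu₁ a.1 b.1))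
        (fun a b c => (tr a.1 b.1 c.1,
          theta b.1 c.1 a.2 - theta a.1 c.1 b.2 + DMap br rho theta a.1 b.1 c.2
            + psi₁ a.1 b.1 c.1))
        (fun a => (T a.1, chi₁ a.1 + TV a.2)))
    (hext₂ : IsLYAlgebra (L := L × V) K
        (fun a b => (br a.1 b.1, rho a.1 b.2 - rho b.1 a.2 + nu₂ a.1 b.1))
        (fun a b c => (tr a.1 b.1 c.1,
          theta b.1 c.1 a.2 - theta a.1 c.1 b.2 + DMap br rho theta a.1 b.1 c.2
            + psi₂ a.1 b.1 c.1)) ∧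
      IsReynoldsOp (L := L × V) K lam
        (fun a b => (br a.1 b.1, rho a.1 b.2 - rho b.1 a.2 + nu₂ a.1 b.1))
        (fun a b c => (tr a.1 b.1 c.1,
          theta b.1 c.1 a.2 - theta a.1 c.1 b.2 + DMap br rho theta a.1 b.1 c.2
            + psi₂ a.1 b.1 c.1))
        (fun a => (T a.1, chi₂ a.1 + TV a.2)))
    (iota : L → V) (hiota : IsLinearMap K iota)
    (hnu : ∀ x y, nu₁ x y = nu₂ x y + rho x (iota y) - rho y (iota x) - iota (br x y))
    (hpsi : ∀ x y z, psi₁ x y z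
      = psi₂ x y z + DMap br rho theta x y (iota z) + theta y z (iota x)
        - theta x z (iota y) - iota (tr x y z))
    (hchi : ∀ x, chi₁ x = chi₂ x + TV (iota x) - iota (T x)) :
    Function.Bijective (fun a : L × V => (a.1, iota a.1 + a.2)) ∧
    IsLinearMap K (fun a : L × V => (a.1, iota a.1 + a.2)) ∧
    (∀ A B : L × V,
      (fun a : L × V => (a.1, iota a.1 + a.2))
          ((br A.1 B.1, rho A.1 B.2 - rho B.1 A.2 + nu₁ A.1 B.1) : L × V)
        = (br ((fun a : L × V => (a.1, iota a.1 + a.2)) A).1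
              ((fun a : L × V => (a.1, iota a.1 + a.2)) B).1,
            rho ((fun a : L × V => (a.1, iota a.1 + a.2)) A).1
                ((fun a : L × V => (a.1, iota a.1 + a.2)) B).2
              - rho ((fun a : L × V => (a.1, iota a.1 + a.2)) B).1
                  ((fun a : L × V => (a.1, iota a.1 + a.2)) A).2
              + nu₂ ((fun a : L × V => (a.1, iota a.1 + a.2)) A).1
                  ((fun a : L × V => (a.1, iota a.1 + a.2)) B).1)) ∧
    (∀ A B C : L × V,
      (fun a : L × V => (a.1, iota a.1 + a.2))
          ((tr A.1 B.1 C.1,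
            theta B.1 C.1 A.2 - theta A.1 C.1 B.2 + DMap br rho theta A.1 B.1 C.2
              + psi₁ A.1 B.1 C.1) : L × V)
        = (tr A.1 B.1 C.1,
            theta B.1 C.1 (iota A.1 + A.2) - theta A.1 C.1 (iota B.1 + B.2)
              + DMap br rho theta A.1 B.1 (iota C.1 + C.2) + psi₂ A.1 B.1 C.1)) ∧
    (∀ A : L × V,
      (fun a : L × V => (a.1, iota a.1 + a.2)) ((T A.1, chi₁ A.1 + TV A.2) : L × V)
        = (T A.1, chi₂ A.1 + TV (iota A.1 + A.2))) ∧
    (∀ u : V, (fun a : L × V => (a.1, iota a.1 + a.2)) ((0, u) : L × V) = (0, u)) ∧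
    (∀ A : L × V, ((fun a : L × V => (a.1, iota a.1 + a.2)) A).1 = A.1) := by
  obtain ⟨⟨-, hrho, -, -, htheta, -⟩, hTV, -⟩ := hrep
  have rho_add : ∀ x u v, rho x (u + v) = rho x u + rho x v := fun x => (hrho x).map_add
  have theta_add : ∀ x y u v, theta x y (u + v) = theta x y u + theta x y v :=
    fun x y => (htheta x y).map_add
  have DMap_add : ∀ x y u v, DMap br rho theta x y (u + v)
      = DMap br rho theta x y u + DMap br rho theta x y v := by
    intro x y u v
    simp only [DMap, rho_add, theta_add]
    abel
  refine ⟨⟨?_, ?_⟩, ⟨?_, ?_⟩, ?_, ?_, ?_, ?_, fun _ => rfl⟩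
  · rintro ⟨x, u⟩ ⟨y, v⟩ h
    obtain ⟨rfl, h⟩ := Prod.mk.inj h
    exact Prod.ext rfl (add_left_cancel h)
  · rintro ⟨x, u⟩
    exact ⟨(x, u - iota x), by simp⟩
  · intro A B
    ext
    · rfl
    · simp only [Prod.fst_add, Prod.snd_add, hiota.map_add]
      abel
  · intro c A
    ext
    · rfl
    · simp only [Prod.smul_fst, Prod.smul_snd, hiota.map_smul, smul_add]
  · intro A B
    ext
    · rfl
    · simp only [hnu, rho_add]
      abel
  · intro A B C
    ext
    · rfl
    · simp only [hpsi, theta_add, DMap_add]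
      abel
  · intro A
    ext
    · rfl
    · simp only [hchi, hTV.map_add]
      abel
  · intro u
    simp only [hiota.map_zero, zero_add]
end

section
/- Let (L,T) be a Reynolds Lie–Yamaguti algebra of weight λ and (V;ρ,θ,T_V) a representation of it, with D(x,y) := θ(y,x) - θ(x,y) - ρ([x,y]) + ρ(x)ρ(y) - ρ(y)ρ(x). Then for all x,y in L and u in V: D(Tx,Ty)T_V u = T_V(D(Tx,Ty)u + D(Tx,y)T_V u + D(x,Ty)T_V u + 2λD(Tx,Ty)T_V u). -/
open Finset

variable (K : Type*) [Field K] [CharZero K]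
variable {L : Type*} [AddCommGroup L] [Module K L]
variable {V : Type*} [AddCommGroup V] [Module K V]

/-- The Reynolds condition for `ρ` passes to products `ρ(x)ρ(y)`, with weight `2 * lam`. -/
theorem reynolds_rho_comp (lam : K) (T : L → L) (rho : L → V → V) (TV : V → V)
    (hlin : ∀ x, IsLinearMap K (rho x))
    (hrho : ∀ x u, rho (T x) (TV u)
      = TV (rho (T x) u + rho x (TV u) + lam • rho (T x) (TV u))) (x y : L) (u : V) :
    rho (T x) (rho (T y) (TV u))
      = TV (rho (T x) (rho (T y) u) + rho (T x) (rho y (TV u)) + rho x (rho (T y) (TV u))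
          + (2 * lam) • rho (T x) (rho (T y) (TV u))) := by
  conv_lhs => rw [hrho y u, hrho x, ← hrho y u, (hlin _).map_add, (hlin _).map_add,
    (hlin _).map_smul]
  congr 1
  module

/-- The Reynolds condition for `ρ` passes to `ρ([x,y])`, with weight `2 * lam`. -/
theorem reynolds_rho_bracket (lam : K) (br : L → L → L) (T : L → L) (rho : L → V → V)
    (TV : V → V) (hlin : ∀ u, IsLinearMap K fun x => rho x u)
    (hbr : ∀ x y, br (T x) (T y) = T (br (T x) y + br x (T y) + lam • br (T x) (T y)))
    (hrho : ∀ x u, rho (T x) (TV u)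
      = TV (rho (T x) u + rho x (TV u) + lam • rho (T x) (TV u))) (x y : L) (u : V) :
    rho (br (T x) (T y)) (TV u)
      = TV (rho (br (T x) (T y)) u + rho (br (T x) y) (TV u) + rho (br x (T y)) (TV u)
          + (2 * lam) • rho (br (T x) (T y)) (TV u)) := by
  have hadd (a b : L) (v : V) : rho (a + b) v = rho a v + rho b v := (hlin v).map_add a b
  have hsmul (c : K) (a : L) (v : V) : rho (c • a) v = c • rho a v := (hlin v).map_smul c a
  conv_lhs => rw [hbr x y, hrho, ← hbr x y, hadd, hadd, hsmul]
  congr 1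
  module

/-- the Reynolds compatibility condition (3.5) for `D`. -/
theorem stmt15 (lam : K) (br : L → L → L) (tr : L → L → L → L) (T : L → L)
    (rho : L → V → V) (theta : L → L → V → V) (TV : V → V)
    (hLY : IsLYAlgebra K br tr) (hT : IsReynoldsOp K lam br tr T)
    (hrep : IsReynoldsRep K lam br tr T rho theta TV) :
    ∀ x y u, DMap br rho theta (T x) (T y) (TV u)
      = TV (DMap br rho theta (T x) (T y) u + DMap br rho theta (T x) y (TV u)
          + DMap br rho theta x (T y) (TV u)
          + (2 * lam) • DMap br rho theta (T x) (T y) (TV u)) := by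
  obtain ⟨-, hbr, -⟩ := hT
  obtain ⟨⟨hlin₁, hlin₂, -⟩, hTV, hrho, htheta⟩ := hrep
  intro x y u
  conv_lhs => rw [DMap, htheta y x u, htheta x y u,
    reynolds_rho_bracket K lam br T rho TV hlin₁ hbr hrho x y u,
    reynolds_rho_comp K lam T rho TV hlin₂ hrho x y u,
    reynolds_rho_comp K lam T rho TV hlin₂ hrho y x u,
    ← hTV.map_sub, ← hTV.map_sub, ← hTV.map_add, ← hTV.map_sub]
  congr 1
  simp only [DMap]
  module
end

section
/- Let (L,⋆) be a (left) Leibniz algebra over a field K of characteristic zero, i.e. a K-vector space with a bilinear product ⋆ satisfying x⋆(y⋆z) = (x⋆y)⋆z + y⋆(x⋆z) for all x,y,z. Define [x,y] := x⋆y - y⋆x and {x,y,z} := -(x⋆y)⋆z. Then (L, [-,-], {-,-,-}) is a Lie–Yamaguti algebra. -/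
open Finset

variable (K : Type*) [Field K] [CharZero K]
variable {L : Type*} [AddCommGroup L] [Module K L]
variable {V : Type*} [AddCommGroup V] [Module K V]

/-- a (left) Leibniz algebra gives rise to a Lie–Yamaguti algebra via
`[x,y] = x⋆y - y⋆x` and `{x,y,z} = -(x⋆y)⋆z`. -/
theorem stmt16 (mul : L → L → L)
    (hmull : ∀ y, IsLinearMap K fun x => mul x y)
    (hmulr : ∀ x, IsLinearMap K (mul x))
    (hleib : ∀ x y z, mul x (mul y z) = mul (mul x y) z + mul y (mul x z)) :
    IsLYAlgebra K (fun x y => mul x y - mul y x)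
      (fun x y z => -(mul (mul x y) z)) := by
  have ladd (x y z : L) : mul (x + y) z = mul x z + mul y z := (hmull z).map_add x y
  have lsmul (c : K) (x z : L) : mul (c • x) z = c • mul x z := (hmull z).map_smul c x
  have lneg (x z : L) : mul (-x) z = -mul x z := (hmull z).map_neg x
  have lsub (x y z : L) : mul (x - y) z = mul x z - mul y z := (hmull z).map_sub x y
  have radd (x y z : L) : mul x (y + z) = mul x y + mul x z := (hmulr x).map_add y z
  have rsmul (c : K) (x z : L) : mul x (c • z) = c • mul x z := (hmulr x).map_smul c z
  have rneg (x z : L) : mul x (-z) = -mul x z := (hmulr x).map_neg z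
  have rsub (x y z : L) : mul x (y - z) = mul x y - mul x z := (hmulr x).map_sub y z
  have assoc (x y z : L) : mul (mul x y) z = mul x (mul y z) - mul y (mul x z) :=
    eq_sub_of_add_eq (hleib x y z).symm
  refine ⟨fun y => ⟨?_, ?_⟩, fun x => ⟨?_, ?_⟩, fun y z => ⟨?_, ?_⟩, fun x z => ⟨?_, ?_⟩,
    fun x y => ⟨?_, ?_⟩, ?_, ?_, ?_, ?_, ?_, ?_⟩ <;> intros <;>
    simp only [ladd, lsmul, lneg, lsub, radd, rsmul, rneg, rsub, assoc, smul_sub, smul_neg] <;>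
    abel
end

section
/- Let (L,⋆) be a (left) Leibniz algebra over a field K of characteristic zero, i.e. x⋆(y⋆z) = (x⋆y)⋆z + y⋆(x⋆z) for all x,y,z, and let T : L → L be a linear map satisfying T(x)⋆T(y) = T(T(x)⋆y + x⋆T(y) + λT(x)⋆T(y)) for all x,y (a Reynolds operator of weight λ on the Leibniz algebra). Define [x,y] := x⋆y - y⋆x and {x,y,z} := -(x⋆y)⋆z. Then T satisfies the Reynolds identities for these brackets: [Tx,Ty] = T([Tx,y] + [x,Ty] + λ[Tx,Ty]) and {Tx,Ty,Tz} = T({x,Ty,Tz} + {Tx,y,Tz} + {Tx,Ty,z} + 2λ{Tx,Ty,Tz}) for all x,y,z in L; i.e. T is a Reynolds operator of weight λ on the induced Lie–Yamaguti algebra. -/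
open Finset

variable (K : Type*) [Field K] [CharZero K]
variable {L : Type*} [AddCommGroup L] [Module K L]
variable {V : Type*} [AddCommGroup V] [Module K V]

/-- a Reynolds operator of weight `lam` on a Leibniz algebra is a
Reynolds operator of weight `lam` on the induced Lie–Yamaguti algebra. -/
theorem stmt17 (lam : K) (mul : L → L → L) (T : L → L)
    (hmull : ∀ y, IsLinearMap K fun x => mul x y)
    (hmulr : ∀ x, IsLinearMap K (mul x))
    (hleib : ∀ x y z, mul x (mul y z) = mul (mul x y) z + mul y (mul x z))
    (hTlin : IsLinearMap K T)
    (hTReyn : ∀ x y, mul (T x) (T y)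
      = T (mul (T x) y + mul x (T y) + lam • mul (T x) (T y))) :
    IsReynoldsOp K lam (fun x y => mul x y - mul y x)
      (fun x y z => -(mul (mul x y) z)) T := by
  have hml : ∀ x y z, mul (x + y) z = mul x z + mul y z := fun x y z => (hmull z).map_add x y
  have hms : ∀ (c : K) x z, mul (c • x) z = c • mul x z := fun c x z => (hmull z).map_smul c x
  refine ⟨hTlin, fun x y => ?_, fun x y z => ?_⟩
  · change mul (T x) (T y) - mul (T y) (T x) = _
    rw [hTReyn x y, hTReyn y x, ← hTlin.map_sub]
    congr 1
    beta_reduce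
    module
  · have h := hTReyn (mul (T x) y + mul x (T y) + lam • mul (T x) (T y)) z
    rw [← hTReyn x y] at h
    change -(mul (mul (T x) (T y)) (T z)) = _
    rw [h, ← hTlin.map_neg]
    congr 1
    simp only [hml, hms]
    module
end
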